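/- Let h : ℝ^d → ℝ be strictly convex, and let μ, ν be Borel probability measures on ℝ^d with compact support that are absolutely continuous with respect to Lebesgue measure. Then there exists a Borel map T : ℝ^d → ℝ^d with T_#μ = ν that minimizes ∫ h(x − T(x)) dμ(x) over all Borel maps S with S_#μ = ν, and any two such minimizers agree μ-almost everywhere. -/

import Mathlib

open MeasureTheory Filter Topology

section Duality

variable {X Y : Type*} [TopologicalSpace X] [CompactSpace X] [MeasurableSpace X]
  [TopologicalSpace Y] [CompactSpace Y] [MeasurableSpace Y]

/-- The total integrals of the continuous pairs `(φ, ψ)` whose sum `φ x + ψ y` dominates `u`. -/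
def majorantValues (μ : Measure X) (ν : Measure Y) (u : C(X × Y, ℝ)) : Set ℝ :=
  {r | ∃ (φ : C(X, ℝ)) (ψ : C(Y, ℝ)), (∀ x y, u (x, y) ≤ φ x + ψ y) ∧
    ∫ x, φ x ∂μ + ∫ y, ψ y ∂ν = r}

lemma majorantValues_nonempty (μ : Measure X) (ν : Measure Y) (u : C(X × Y, ℝ)) :
    (majorantValues μ ν u).Nonempty :=
  ⟨_, ContinuousMap.const X ‖u‖, 0, fun x y => by
    simpa using (le_abs_self _).trans (u.norm_coe_le_norm (x, y)), rfl⟩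

variable [BorelSpace X] [BorelSpace Y]

lemma ContinuousMap.integrable_of_compactSpace (μ : Measure X) [IsFiniteMeasure μ] (φ : C(X, ℝ)) :
    Integrable φ μ :=
  φ.continuous.integrable_of_hasCompactSupport (HasCompactSupport.of_compactSpace _)

variable (μ : Measure X) (ν : Measure Y) [IsProbabilityMeasure μ] [IsProbabilityMeasure ν]

lemma le_of_mem_majorantValues {u : C(X × Y, ℝ)} {m r : ℝ} (hm : ∀ p, m ≤ u p)
    (hr : r ∈ majorantValues μ ν u) : m ≤ r := by
  obtain ⟨φ, ψ, h, rfl⟩ := hr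
  have hφ := φ.integrable_of_compactSpace μ
  have hψ := ψ.integrable_of_compactSpace ν
  have h1 : ∀ y, m - ψ y ≤ ∫ x, φ x ∂μ := fun y => by
    have := integral_mono (integrable_const (m - ψ y)) hφ
      (fun x => by linarith [h x y, hm (x, y)])
    simpa using this
  have h2 := integral_mono (integrable_const (m - ∫ x, φ x ∂μ)) hψ
    (fun y => by linarith [h1 y])
  simp only [integral_const, probReal_univ, smul_eq_mul, one_mul] at h2
  linarith

lemma bddBelow_majorantValues (u : C(X × Y, ℝ)) : BddBelow (majorantValues μ ν u) :=
  ⟨-‖u‖, fun _ hr => le_of_mem_majorantValues μ ν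
    (fun p => neg_le_of_abs_le (u.norm_coe_le_norm p)) hr⟩

lemma sInf_majorantValues_add (u v : C(X × Y, ℝ)) :
    sInf (majorantValues μ ν (u + v)) ≤
      sInf (majorantValues μ ν u) + sInf (majorantValues μ ν v) := by
  rw [← csInf_add (majorantValues_nonempty μ ν u) (bddBelow_majorantValues μ ν u)
    (majorantValues_nonempty μ ν v) (bddBelow_majorantValues μ ν v)]
  refine csInf_le_csInf (bddBelow_majorantValues μ ν _)
    ((majorantValues_nonempty μ ν u).add (majorantValues_nonempty μ ν v)) ?_
  rintro _ ⟨_, ⟨φ, ψ, h, rfl⟩, _, ⟨φ', ψ', h', rfl⟩, rfl⟩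
  refine ⟨φ + φ', ψ + ψ', fun x y => ?_, ?_⟩
  · simp only [ContinuousMap.add_apply]
    linarith [h x y, h' x y]
  · simp only [ContinuousMap.add_apply]
    rw [integral_add (φ.integrable_of_compactSpace μ) (φ'.integrable_of_compactSpace μ),
      integral_add (ψ.integrable_of_compactSpace ν) (ψ'.integrable_of_compactSpace ν)]
    ring

lemma sInf_majorantValues_smul_le {t : ℝ} (ht : 0 < t) (u : C(X × Y, ℝ)) :
    sInf (majorantValues μ ν (t • u)) ≤ t * sInf (majorantValues μ ν u) := by
  rw [← div_le_iff₀' ht]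
  refine le_csInf (majorantValues_nonempty μ ν u) ?_
  rintro _ ⟨φ, ψ, h, rfl⟩
  rw [div_le_iff₀' ht]
  refine csInf_le (bddBelow_majorantValues μ ν _) ⟨t • φ, t • ψ, fun x y => ?_, ?_⟩
  · simp only [ContinuousMap.smul_apply, smul_eq_mul, ← mul_add]
    exact mul_le_mul_of_nonneg_left (h x y) ht.le
  · simp only [ContinuousMap.smul_apply, smul_eq_mul, integral_const_mul]
    ring

lemma sInf_majorantValues_smul {t : ℝ} (ht : 0 < t) (u : C(X × Y, ℝ)) :
    sInf (majorantValues μ ν (t • u)) = t * sInf (majorantValues μ ν u) := by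
  refine (sInf_majorantValues_smul_le μ ν ht u).antisymm ?_
  have := sInf_majorantValues_smul_le μ ν (inv_pos.2 ht) (t • u)
  rwa [inv_smul_smul₀ ht.ne', inv_mul_eq_div, le_div_iff₀' ht] at this

/-- A sublinear functional on a real vector space dominates a linear functional which it
equals at a given vector. -/
lemma exists_linearMap_le_sublinear_eq {E : Type*} [AddCommGroup E] [Module ℝ E] (N : E → ℝ)
    (N_hom : ∀ t : ℝ, 0 < t → ∀ x, N (t • x) = t * N x) (N_add : ∀ x y, N (x + y) ≤ N x + N y)
    (v : E) : ∃ g : E →ₗ[ℝ] ℝ, (∀ x, g x ≤ N x) ∧ g v = N v := by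
  have N_0 : N 0 = 0 := by
    have := N_hom 2 (by norm_num) 0
    rw [smul_zero] at this
    linarith
  obtain ⟨g, hg, hgN⟩ := exists_extension_of_le_sublinear
    (LinearPMap.mkSpanSingleton' (σ := RingHom.id ℝ) v (N v) (by
      intro t ht
      rcases smul_eq_zero.1 ht with rfl | rfl
      · simp
      · simp [N_0])) N N_hom N_add (by
      rintro ⟨x, hx⟩
      obtain ⟨t, rfl⟩ := Submodule.mem_span_singleton.1 hx
      rw [LinearPMap.mkSpanSingleton'_apply]
      simp only [RingHom.id_apply, smul_eq_mul]
      rcases lt_trichotomy t 0 with ht | rfl | ht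
      · have h1 := N_add (t • v) ((-t) • v)
        rw [← add_smul, add_neg_cancel, zero_smul, N_0, N_hom (-t) (by linarith)] at h1
        linarith
      · simp [N_0]
      · rw [N_hom t ht])
  refine ⟨g, hgN, ?_⟩
  exact (hg ⟨v, Submodule.mem_span_singleton_self v⟩).trans
    (LinearPMap.mkSpanSingleton'_apply_self _ _ _ _)

/-- On a compact space every positive linear functional on continuous functions is integration
against a finite measure. -/
lemma exists_integral_eq_of_nonneg [T2Space X] (g : C(X, ℝ) →ₗ[ℝ] ℝ)
    (hg : ∀ u : C(X, ℝ), (∀ x, 0 ≤ u x) → 0 ≤ g u) :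
    ∃ π : Measure X, IsFiniteMeasure π ∧ ∀ u : C(X, ℝ), ∫ x, u x ∂π = g u := by
  let Λ : CompactlySupportedContinuousMap X ℝ →ₚ[ℝ] ℝ := PositiveLinearMap.mk₀
    { toFun := fun f => g f.toContinuousMap
      map_add' := fun f f' => g.map_add f.toContinuousMap f'.toContinuousMap
      map_smul' := fun t f => g.map_smul t f.toContinuousMap }
    (fun f hf => hg _ hf)
  refine ⟨RealRMK.rieszMeasure Λ, ?_, fun u => ?_⟩
  · infer_instance
  · exact RealRMK.integral_rieszMeasure Λ ⟨u, HasCompactSupport.of_compactSpace _⟩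

/-- **Kantorovich duality** on compact spaces: there is a coupling whose cost is the supremum
of the dual problem. -/
theorem exists_coupling_dual [T2Space X] [T2Space Y]
    [SecondCountableTopology X] [SecondCountableTopology Y] [HasOuterApproxClosed X]
    [HasOuterApproxClosed Y] (c : C(X × Y, ℝ)) :
    ∃ π : Measure (X × Y), π.map Prod.fst = μ ∧ π.map Prod.snd = ν ∧
      ∀ ε > 0, ∃ (φ : C(X, ℝ)) (ψ : C(Y, ℝ)), (∀ x y, φ x + ψ y ≤ c (x, y)) ∧
        ∫ p, c p ∂π - ε < ∫ x, φ x ∂μ + ∫ y, ψ y ∂ν := by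
  obtain ⟨g, hgN, hgc⟩ := exists_linearMap_le_sublinear_eq
    (fun u : C(X × Y, ℝ) => sInf (majorantValues μ ν u))
    (fun t ht u => sInf_majorantValues_smul μ ν ht u) (sInf_majorantValues_add μ ν) (-c)
  have hle : ∀ (u : C(X × Y, ℝ)) (φ : C(X, ℝ)) (ψ : C(Y, ℝ)), (∀ x y, u (x, y) ≤ φ x + ψ y) →
      g u ≤ ∫ x, φ x ∂μ + ∫ y, ψ y ∂ν := fun u φ ψ h =>
    (hgN u).trans (csInf_le (bddBelow_majorantValues μ ν u) ⟨φ, ψ, h, rfl⟩)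
  have heq : ∀ (u : C(X × Y, ℝ)) (φ : C(X, ℝ)) (ψ : C(Y, ℝ)), (∀ x y, u (x, y) = φ x + ψ y) →
      g u = ∫ x, φ x ∂μ + ∫ y, ψ y ∂ν := fun u φ ψ h => by
    refine (hle u φ ψ fun x y => (h x y).le).antisymm ?_
    have := hle (-u) (-φ) (-ψ) fun x y => by simp [h, add_comm]
    simp only [map_neg, ContinuousMap.neg_apply, integral_neg] at this
    linarith
  obtain ⟨π, hπ, hπg⟩ := exists_integral_eq_of_nonneg g (fun u hu => by
    have := hle (-u) 0 0 fun x y => by simpa using hu (x, y)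
    simpa using this)
  refine ⟨π, ?_, ?_, fun ε hε => ?_⟩
  · refine ext_of_forall_integral_eq_of_IsFiniteMeasure fun f => ?_
    rw [integral_map measurable_fst.aemeasurable f.continuous.aestronglyMeasurable]
    have := hπg (f.toContinuousMap.comp ContinuousMap.fst)
    rw [heq _ f.toContinuousMap 0 (by simp)] at this
    simpa using this
  · refine ext_of_forall_integral_eq_of_IsFiniteMeasure fun f => ?_
    rw [integral_map measurable_snd.aemeasurable f.continuous.aestronglyMeasurable]
    have := hπg (f.toContinuousMap.comp ContinuousMap.snd)
    rw [heq _ 0 f.toContinuousMap (by simp)] at this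
    simpa using this
  · have hlt : sInf (majorantValues μ ν (-c)) < - ∫ p, c p ∂π + ε := by
      rw [← hgc, map_neg, hπg]
      linarith
    obtain ⟨_, ⟨φ, ψ, h, rfl⟩, hr⟩ := exists_lt_of_csInf_lt (majorantValues_nonempty μ ν _) hlt
    refine ⟨-φ, -ψ, fun x y => ?_, ?_⟩
    · have := h x y
      simp only [ContinuousMap.neg_apply] at this ⊢
      linarith
    · simp only [ContinuousMap.neg_apply, integral_neg]
      linarith

end Duality

lemma Continuous.integrable_of_measure_compl_eq_zero {E : Type*} [TopologicalSpace E]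
    [T2Space E] [MeasurableSpace E] [BorelSpace E] [SecondCountableTopology E] {μ : Measure E}
    [IsFiniteMeasure μ] {K : Set E} (hK : IsCompact K)
    (hμ : μ Kᶜ = 0) {f : E → ℝ} (hf : Continuous f) : Integrable f μ := by
  have h := hf.continuousOn.integrableOn_compact hK (μ := μ)
  rwa [IntegrableOn, Measure.restrict_eq_self_of_ae_mem (s := K) (mem_ae_iff.2 hμ)] at h

lemma isProbabilityMeasure_of_map_eq {α β : Type*} [MeasurableSpace α] [MeasurableSpace β]
    {P : Measure α} {μ : Measure β} [IsProbabilityMeasure μ] {f : α → β} (hf : Measurable f)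
    (h : P.map f = μ) : IsProbabilityMeasure P := by
  constructor
  rw [← measure_univ (μ := μ), ← h, Measure.map_apply hf .univ, Set.preimage_univ]

lemma ae_mem_prod_of_map_eq {α β : Type*} [MeasurableSpace α] [MeasurableSpace β]
    {P : Measure (α × β)} {μ : Measure α} {ν : Measure β} (h1 : P.map Prod.fst = μ)
    (h2 : P.map Prod.snd = ν) {A : Set α} {B : Set β} (hμ : μ Aᶜ = 0) (hν : ν Bᶜ = 0) :
    ∀ᵐ p ∂P, p ∈ A ×ˢ B := by
  have h3 : ∀ᵐ p ∂P, p.1 ∈ A :=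
    ae_of_ae_map measurable_fst.aemeasurable (p := (· ∈ A)) (h1.symm ▸ mem_ae_iff.2 hμ)
  have h4 : ∀ᵐ p ∂P, p.2 ∈ B :=
    ae_of_ae_map measurable_snd.aemeasurable (p := (· ∈ B)) (h2.symm ▸ mem_ae_iff.2 hν)
  filter_upwards [h3, h4] with p hp hp' using ⟨hp, hp'⟩

lemma integral_add_of_map_eq {α β : Type*} [MeasurableSpace α] [MeasurableSpace β]
    {P : Measure (α × β)} {μ : Measure α} {ν : Measure β} (h1 : P.map Prod.fst = μ)
    (h2 : P.map Prod.snd = ν) {φ : α → ℝ} {ψ : β → ℝ} (hφ : Integrable φ μ)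
    (hψ : Integrable ψ ν) :
    Integrable (fun p : α × β => φ p.1 + ψ p.2) P ∧
      ∫ p, (φ p.1 + ψ p.2) ∂P = ∫ x, φ x ∂μ + ∫ y, ψ y ∂ν := by
  subst h1 h2
  refine ⟨(hφ.comp_measurable measurable_fst).add (hψ.comp_measurable measurable_snd), ?_⟩
  rw [integral_map measurable_fst.aemeasurable hφ.1,
    integral_map measurable_snd.aemeasurable hψ.1]
  exact integral_add (hφ.comp_measurable measurable_fst) (hψ.comp_measurable measurable_snd)

section Coupling

variable {E : Type*} [MetricSpace E] [SecondCountableTopology E] [MeasurableSpace E] [BorelSpace E]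

/-- The dual Kantorovich problem for the cost `c` on `K × K` has value at least `D`. -/
def DualValueAtLeast (c : E × E → ℝ) (K : Set E) (μ ν : Measure E) (D : ℝ) : Prop :=
  ∀ ε > 0, ∃ φ ψ : E → ℝ, Integrable φ μ ∧ Integrable ψ ν ∧
    (∀ x ∈ K, ∀ y ∈ K, φ x + ψ y ≤ c (x, y)) ∧ D - ε < ∫ x, φ x ∂μ + ∫ y, ψ y ∂ν

variable {K : Set E} {μ ν : Measure E} [IsProbabilityMeasure μ]

theorem exists_coupling_dualValueAtLeast [IsProbabilityMeasure ν] (hK : IsCompact K)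
    (hμ : μ Kᶜ = 0) (hν : ν Kᶜ = 0) {c : E × E → ℝ} (hc : Continuous c) :
    ∃ P : Measure (E × E), P.map Prod.fst = μ ∧ P.map Prod.snd = ν ∧
      DualValueAtLeast c K μ ν (∫ p, c p ∂P) := by
  have : CompactSpace K := isCompact_iff_compactSpace.1 hK
  have hval : MeasurableEmbedding (Subtype.val : K → E) :=
    MeasurableEmbedding.subtype_coe hK.measurableSet
  have hmap : ∀ ρ : Measure E, ρ Kᶜ = 0 → (ρ.comap (Subtype.val : K → E)).map Subtype.val = ρ :=
    fun ρ hρ => by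
      rw [hval.map_comap, Subtype.range_coe,
        Measure.restrict_eq_self_of_ae_mem (s := K) (mem_ae_iff.2 hρ)]
  have hprob : ∀ ρ : Measure E, IsProbabilityMeasure ρ → ρ Kᶜ = 0 →
      IsProbabilityMeasure (ρ.comap (Subtype.val : K → E)) := fun ρ _ hρ => by
    exact isProbabilityMeasure_of_map_eq hval.measurable (hmap ρ hρ)
  have := hprob μ inferInstance hμ
  have := hprob ν inferInstance hν
  have hj : Continuous (Prod.map Subtype.val Subtype.val : K × K → E × E) := by fun_prop
  obtain ⟨π, h1, h2, h3⟩ := exists_coupling_dual (μ.comap (Subtype.val : K → E))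
    (ν.comap (Subtype.val : K → E)) ⟨fun p => c (Prod.map Subtype.val Subtype.val p), hc.comp hj⟩
  refine ⟨π.map (Prod.map Subtype.val Subtype.val), ?_, ?_, fun ε hε => ?_⟩
  · rw [Measure.map_map measurable_fst hj.measurable, ← hmap μ hμ, ← h1,
      Measure.map_map measurable_subtype_coe measurable_fst]
    rfl
  · rw [Measure.map_map measurable_snd hj.measurable, ← hmap ν hν, ← h2,
      Measure.map_map measurable_subtype_coe measurable_snd]
    rfl
  · obtain ⟨φ, ψ, hφψ, hlt⟩ := h3 ε hε
    obtain ⟨φ', hφ'⟩ := φ.exists_restrict_eq hK.isClosed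
    obtain ⟨ψ', hψ'⟩ := ψ.exists_restrict_eq hK.isClosed
    have hφ : ∀ x, φ x = φ' x := fun x => by rw [← hφ']; rfl
    have hψ : ∀ x, ψ x = ψ' x := fun x => by rw [← hψ']; rfl
    refine ⟨φ', ψ', φ'.continuous.integrable_of_measure_compl_eq_zero hK hμ,
      ψ'.continuous.integrable_of_measure_compl_eq_zero hK hν, fun x hx y hy => ?_, ?_⟩
    · have := hφψ ⟨x, hx⟩ ⟨y, hy⟩
      rwa [hφ, hψ] at this
    · rw [integral_map hj.measurable.aemeasurable hc.aestronglyMeasurable]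
      conv_rhs => rw [← hmap μ hμ, ← hmap ν hν, hval.integral_map, hval.integral_map]
      simpa only [hφ, hψ, ContinuousMap.coe_mk] using hlt

lemma DualValueAtLeast.le_integral {P : Measure (E × E)} (h1 : P.map Prod.fst = μ)
    (h2 : P.map Prod.snd = ν) (hK : IsCompact K) (hμ : μ Kᶜ = 0) (hν : ν Kᶜ = 0)
    {c : E × E → ℝ} (hc : Continuous c) {D : ℝ} (hD : DualValueAtLeast c K μ ν D) :
    Integrable c P ∧ D ≤ ∫ p, c p ∂P := by
  have := isProbabilityMeasure_of_map_eq measurable_fst h1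
  have hmem := ae_mem_prod_of_map_eq h1 h2 hμ hν
  have hcP := hc.integrable_of_measure_compl_eq_zero (hK.prod hK) (mem_ae_iff.1 hmem)
  refine ⟨hcP, le_of_forall_pos_lt_add fun ε hε => ?_⟩
  obtain ⟨φ, ψ, hφ, hψ, hle, hlt⟩ := hD ε hε
  obtain ⟨hi, heq⟩ := integral_add_of_map_eq h1 h2 hφ hψ
  have := integral_mono_ae hi hcP (hmem.mono fun p hp => hle _ hp.1 _ hp.2)
  linarith

/-- For an optimal coupling, some maximizing sequence of the dual problem converges to the cost
almost everywhere. -/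
lemma DualValueAtLeast.exists_seq_tendsto {P : Measure (E × E)} (h1 : P.map Prod.fst = μ)
    (h2 : P.map Prod.snd = ν) (hK : IsCompact K) (hμ : μ Kᶜ = 0) (hν : ν Kᶜ = 0)
    {c : E × E → ℝ} (hc : Continuous c) {D : ℝ} (hD : DualValueAtLeast c K μ ν D)
    (hP : ∫ p, c p ∂P ≤ D) :
    ∃ a b : ℕ → E → ℝ, (∀ n, ∀ x ∈ K, ∀ y ∈ K, a n x + b n y ≤ c (x, y)) ∧
      ∀ᵐ p ∂P, Tendsto (fun n => a n p.1 + b n p.2) atTop (𝓝 (c p)) := by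
  have := isProbabilityMeasure_of_map_eq measurable_fst h1
  have hmem := ae_mem_prod_of_map_eq h1 h2 hμ hν
  have hcP := (hD.le_integral h1 h2 hK hμ hν hc).1
  choose a b ha hb hle hlt using fun n : ℕ => hD (1 / ((n : ℝ) + 1)) (by positivity)
  have hint := fun n => integral_add_of_map_eq h1 h2 (ha n) (hb n)
  have hL1 : Tendsto (fun n => eLpNorm ((fun p : E × E => a n p.1 + b n p.2) - c) 1 P) atTop
      (𝓝 0) := by
    refine tendsto_of_tendsto_of_tendsto_of_le_of_le tendsto_const_nhds
      (h := fun n : ℕ => ENNReal.ofReal (1 / ((n : ℝ) + 1))) ?_ (fun _ => zero_le) fun n => ?_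
    · simpa using ENNReal.tendsto_ofReal (tendsto_one_div_add_atTop_nhds_zero_nat (𝕜 := ℝ))
    · simp only [eLpNorm_one_eq_lintegral_enorm]
      rw [← ofReal_integral_norm_eq_lintegral_enorm ((hint n).1.sub hcP)]
      refine ENNReal.ofReal_le_ofReal ?_
      have : ∫ p, ‖((fun p : E × E => a n p.1 + b n p.2) - c) p‖ ∂P =
          ∫ p, (c p - (a n p.1 + b n p.2)) ∂P := by
        refine integral_congr_ae (hmem.mono fun p hp => ?_)
        have := hle n _ hp.1 _ hp.2
        simp only [Pi.sub_apply, Real.norm_eq_abs]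
        rw [abs_sub_comm, abs_of_nonneg (by linarith)]
      rw [this, integral_sub hcP (hint n).1, (hint n).2]
      linarith [hlt n]
  obtain ⟨ns, -, hns⟩ := (tendstoInMeasure_of_tendsto_eLpNorm one_ne_zero
    (fun n => (hint n).1.1) hcP.1 hL1).exists_seq_tendsto_ae
  exact ⟨fun n => a (ns n), fun n => b (ns n), fun n => hle _, hns⟩

end Coupling

/-- If functions `a n x + b n y ≤ c (x, y)` converge to `c` on `G`, then some function `ψ`
satisfies the inequalities defining a `c`-conjugate pair on `G`. -/
lemma exists_potential_of_tendsto {X Y : Type*} {c : X × Y → ℝ} {a : ℕ → X → ℝ} {b : ℕ → Y → ℝ}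
    {G : Set (X × Y)} {M : ℝ}
    (hle : ∀ n, ∀ p ∈ G, ∀ q ∈ G, a n p.1 + b n q.2 ≤ c (p.1, q.2))
    (hlim : ∀ p ∈ G, Tendsto (fun n => a n p.1 + b n p.2) atTop (𝓝 (c p)))
    (hM : ∀ p ∈ G, ∀ q ∈ G, c (p.1, q.2) ≤ M) :
    ∃ (ψ : Y → ℝ) (M' : ℝ), (∀ p ∈ G, ψ p.2 ≤ M') ∧
      ∀ p ∈ G, ∀ q ∈ G, c p - ψ p.2 ≤ c (p.1, q.2) - ψ q.2 := by
  rcases G.eq_empty_or_nonempty with rfl | ⟨p₀, hp₀⟩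
  · exact ⟨0, 0, by simp, by simp⟩
  have hbd : ∀ p ∈ G, ∃ l, Tendsto (fun n => b n p.2 - b n p₀.2) (hyperfilter ℕ) (𝓝 l) := by
    intro p hp
    obtain ⟨m, hm⟩ := (hlim p hp).bddBelow_range
    obtain ⟨m₀, hm₀⟩ := (hlim p₀ hp₀).bddBelow_range
    have hmem : ∀ n, b n p.2 - b n p₀.2 ∈ Set.Icc (m - M) (M - m₀) := fun n => by
      have e1 := hle n p hp p₀ hp₀
      have e2 := hle n p₀ hp₀ p hp
      have e3 : m ≤ a n p.1 + b n p.2 := hm ⟨n, rfl⟩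
      have e4 : m₀ ≤ a n p₀.1 + b n p₀.2 := hm₀ ⟨n, rfl⟩
      have e5 := hM p hp p₀ hp₀
      have e6 := hM p₀ hp₀ p hp
      constructor <;> linarith
    obtain ⟨l, -, hl⟩ := (isCompact_Icc (a := m - M) (b := M - m₀)).ultrafilter_le_nhds'
      ((hyperfilter ℕ).map fun n => b n p.2 - b n p₀.2)
      (Ultrafilter.mem_map.2 (univ_mem' hmem))
    exact ⟨l, hl⟩
  have hbd' : ∀ y : Y, ∃ l, (∃ p ∈ G, p.2 = y) →
      Tendsto (fun n => b n y - b n p₀.2) (hyperfilter ℕ) (𝓝 l) := fun y => by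
    by_cases h : ∃ p ∈ G, p.2 = y
    · obtain ⟨p, hp, rfl⟩ := h
      exact (hbd p hp).imp fun l hl _ => hl
    · exact ⟨0, fun h' => absurd h' h⟩
  choose ψ hψ using hbd'
  have hψ' : ∀ p ∈ G, Tendsto (fun n => b n p.2 - b n p₀.2) (hyperfilter ℕ) (𝓝 (ψ p.2)) :=
    fun p hp => hψ _ ⟨p, hp, rfl⟩
  have hu : ∀ p ∈ G, Tendsto (fun n => a n p.1 + b n p.2) (hyperfilter ℕ) (𝓝 (c p)) :=
    fun p hp => (hlim p hp).mono_left Nat.hyperfilter_le_atTop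
  have key : ∀ p ∈ G, ∀ q ∈ G, c p - ψ p.2 ≤ c (p.1, q.2) - ψ q.2 := fun p hp q hq => by
    have := le_of_tendsto (((hu p hp).sub (hψ' p hp)).add (hψ' q hq))
      (Eventually.of_forall fun n => show _ ≤ c (p.1, q.2) by linarith [hle n p hp q hq])
    linarith
  refine ⟨ψ, M - c p₀ + ψ p₀.2, fun p hp => ?_, key⟩
  linarith [key p₀ hp₀ p hp, hM p₀ hp₀ p hp]

/-- If a function touches a translate of a convex function from below at `x`, then its derivative
at `x` is a subgradient. -/
lemma ConvexOn.add_fderiv_le_of_sub_le {E : Type*} [NormedAddCommGroup E] [NormedSpace ℝ E]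
    {h : E → ℝ} (hh : ConvexOn ℝ Set.univ h) {f : E → ℝ} {f' : E →L[ℝ] ℝ} {x w : E}
    (hf : HasFDerivAt f f' x) (hle : ∀ v, f (x + v) - f x ≤ h (w + v) - h w) (v : E) :
    h w + f' v ≤ h (w + v) := by
  have hlim := (hf.hasLineDerivAt v).tendsto_slope_zero_right
  have : f' v ≤ h (w + v) - h w := by
    refine le_of_tendsto hlim ?_
    filter_upwards [Ioc_mem_nhdsGT (zero_lt_one (α := ℝ))] with t ht
    have h1 := hle (t • v)
    have h2 := hh.2 (Set.mem_univ w) (Set.mem_univ (w + v)) (sub_nonneg.2 ht.2) ht.1.le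
      (by ring)
    rw [show (1 - t) • w + t • (w + v) = w + t • v by module] at h2
    simp only [smul_eq_mul] at h2 ⊢
    rw [inv_mul_le_iff₀ ht.1]
    linarith
  linarith

lemma StrictConvexOn.eq_of_common_subgradient {E : Type*} [NormedAddCommGroup E]
    [NormedSpace ℝ E] {h : E → ℝ} (hh : StrictConvexOn ℝ Set.univ h) {p : E →L[ℝ] ℝ} {w w' : E}
    (hw : ∀ v, h w + p v ≤ h (w + v)) (hw' : ∀ v, h w' + p v ≤ h (w' + v)) : w = w' := by
  by_contra hne
  have h1 := hh.2 (Set.mem_univ w) (Set.mem_univ w') hne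
    (one_half_pos (α := ℝ)) one_half_pos (add_halves 1)
  have h2 := hw ((1 / 2 : ℝ) • (w' - w))
  have h3 := hw' (w - w')
  rw [show w + (1 / 2 : ℝ) • (w' - w) = (1 / 2 : ℝ) • w + (1 / 2 : ℝ) • w' by module] at h2
  rw [add_sub_cancel] at h3
  simp only [smul_eq_mul, map_smul, map_sub] at h1 h2 h3
  linarith

/-- An infimum of translates of a locally Lipschitz function, with shifts in a bounded set, is
differentiable almost everywhere. -/
lemma LocallyLipschitz.ae_differentiableAt_iInf {E : Type*} [NormedAddCommGroup E]
    [NormedSpace ℝ E] [FiniteDimensional ℝ E] [MeasurableSpace E] [BorelSpace E] (ρ : Measure E)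
    [ρ.IsAddHaarMeasure] {h : E → ℝ} (hh : LocallyLipschitz h) {ι : Type*} [Nonempty ι]
    {y : ι → E} {ψ : ι → ℝ} {R : ℝ} (hy : ∀ i, ‖y i‖ ≤ R)
    (hbdd : ∀ z, BddBelow (Set.range fun i => h (z - y i) - ψ i)) :
    ∀ᵐ z ∂ρ, DifferentiableAt ℝ (fun z => ⨅ i, (h (z - y i) - ψ i)) z := by
  have hball : ∀ n : ℕ, ∀ᵐ z ∂ρ, z ∈ Metric.ball (0 : E) n →
      DifferentiableAt ℝ (fun z => ⨅ i, (h (z - y i) - ψ i)) z := fun n => by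
    obtain ⟨L, hL⟩ := (hh.locallyLipschitzOn
      (s := Metric.closedBall (0 : E) (n + R))).exists_lipschitzOnWith_of_compact
      (isCompact_closedBall _ _)
    have hmem : ∀ z ∈ Metric.ball (0 : E) n, ∀ i, z - y i ∈ Metric.closedBall (0 : E) (n + R) :=
      fun z hz i => by
        rw [mem_ball_zero_iff] at hz
        rw [mem_closedBall_zero_iff]
        linarith [norm_sub_le z (y i), hy i]
    have hLip : LipschitzOnWith L (fun z => ⨅ i, (h (z - y i) - ψ i))
        (Metric.ball (0 : E) n) := by
      refine LipschitzOnWith.of_le_add_mul L fun z hz w hw => ?_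
      rw [← sub_le_iff_le_add]
      refine le_ciInf fun i => ?_
      have h1 := ciInf_le (hbdd z) i
      have h2 := hL.le_add_mul (hmem z hz i) (hmem w hw i)
      rw [dist_sub_right] at h2
      linarith
    filter_upwards [hLip.ae_differentiableWithinAt_of_mem (μ := ρ)] with z hz hzn
    exact (hz hzn).differentiableAt (Metric.isOpen_ball.mem_nhds hzn)
  filter_upwards [ae_all_iff.2 hball] with z hz
  obtain ⟨n, hn⟩ := exists_nat_gt ‖z‖
  exact hz n (mem_ball_zero_iff.2 hn)

lemma StrictConvexOn.ae_minimizer_unique {E : Type*} [NormedAddCommGroup E]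
    [NormedSpace ℝ E] [FiniteDimensional ℝ E] [MeasurableSpace E] [BorelSpace E] (ρ : Measure E)
    [ρ.IsAddHaarMeasure] {h : E → ℝ} (hh : StrictConvexOn ℝ Set.univ h) {ι : Type*}
    {y : ι → E} {ψ : ι → ℝ} {K : Set E} (hK : IsCompact K) (hy : ∀ i, y i ∈ K) {M : ℝ}
    (hψ : ∀ i, ψ i ≤ M) :
    ∀ᵐ x ∂ρ, ∀ i j, (∀ k, h (x - y i) - ψ i ≤ h (x - y k) - ψ k) →
      (∀ k, h (x - y j) - ψ j ≤ h (x - y k) - ψ k) → y i = y j := by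
  rcases isEmpty_or_nonempty ι with _ | _
  · exact Eventually.of_forall fun x i => isEmptyElim i
  have hlip := hh.convexOn.locallyLipschitz
  obtain ⟨R, hR⟩ := hK.isBounded.exists_norm_le
  have hbdd : ∀ z, BddBelow (Set.range fun i => h (z - y i) - ψ i) := fun z => by
    have hc : Continuous fun w => h (z - w) := hlip.continuous.comp (by fun_prop)
    obtain ⟨m, hm⟩ := (hK.image hc).bddBelow
    refine ⟨m - M, ?_⟩
    rintro _ ⟨i, rfl⟩
    have h1 : m ≤ h (z - y i) := hm ⟨y i, hy i, rfl⟩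
    exact sub_le_sub h1 (hψ i)
  filter_upwards [hlip.ae_differentiableAt_iInf ρ (fun i => hR _ (hy i)) hbdd] with x hx i j hi hj
  have hsub : ∀ i, (∀ k, h (x - y i) - ψ i ≤ h (x - y k) - ψ k) → ∀ v,
      h (x - y i) + fderiv ℝ (fun z => ⨅ i, (h (z - y i) - ψ i)) x v ≤ h (x - y i + v) :=
    fun i hi => hh.convexOn.add_fderiv_le_of_sub_le hx.hasFDerivAt fun v => by
      have h1 := ciInf_le (hbdd (x + v)) i
      have h2 : h (x - y i) - ψ i ≤ ⨅ k, (h (x - y k) - ψ k) := le_ciInf hi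
      rw [add_sub_right_comm] at h1
      linarith
  simpa using hh.eq_of_common_subgradient (hsub i hi) (hsub j hj)

/-- A measure concentrated on a set whose sections are almost all singletons is concentrated on
the graph of a measurable map. -/
lemma exists_measurable_ae_eq_of_unique {α E : Type*} [MeasurableSpace α] [NormedAddCommGroup E]
    [NormedSpace ℝ E] [CompleteSpace E] [SecondCountableTopology E] [MeasurableSpace E]
    [BorelSpace E] {P : Measure (α × E)} [IsFiniteMeasure P] {G : Set (α × E)}
    (hG : ∀ᵐ p ∂P, p ∈ G)
    (huniq : ∀ᵐ x ∂(P.map Prod.fst), ∀ y y', (x, y) ∈ G → (x, y') ∈ G → y = y') :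
    ∃ T : α → E, Measurable T ∧ ∀ᵐ p ∂P, p.2 = T p.1 := by
  have hT : Measurable fun x => ∫ y, y ∂(P.condKernel x) :=
    (stronglyMeasurable_id.integral_kernel (κ := P.condKernel)).measurable
  refine ⟨_, hT, ?_⟩
  have hP : P.fst.compProd P.condKernel = P := P.disintegrate P.condKernel
  rw [← hP] at hG
  suffices ∀ᵐ p ∂(P.fst.compProd P.condKernel), p.2 = ∫ y, y ∂(P.condKernel p.1) by
    rwa [hP] at this
  refine Measure.ae_compProd_of_ae_ae
    (measurableSet_eq_fun measurable_snd (hT.comp measurable_fst)) ?_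
  filter_upwards [Measure.ae_ae_of_ae_compProd hG, huniq] with x hx hux
  obtain ⟨y₀, hy₀⟩ := hx.exists
  have hae : ∀ᵐ y ∂(P.condKernel x), y = y₀ := hx.mono fun y hy => hux _ _ hy hy₀
  have hint : ∫ y, y ∂(P.condKernel x) = y₀ := by
    rw [integral_congr_ae hae]
    simp
  rw [hint]
  exact hae

/-- For a strictly convex cost, every optimal coupling with absolutely continuous first marginal
is concentrated on the graph of a measurable map. -/
lemma StrictConvexOn.exists_measurable_ae_eq_of_optimal {E : Type*} [NormedAddCommGroup E]
    [NormedSpace ℝ E] [FiniteDimensional ℝ E] [MeasurableSpace E] [BorelSpace E] (ρ : Measure E)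
    [ρ.IsAddHaarMeasure] {h : E → ℝ} (hh : StrictConvexOn ℝ Set.univ h) {K : Set E}
    (hK : IsCompact K) {μ ν : Measure E} [IsProbabilityMeasure μ] (hμρ : μ ≪ ρ) (hμ : μ Kᶜ = 0)
    (hν : ν Kᶜ = 0) {D : ℝ} (hD : DualValueAtLeast (fun p : E × E => h (p.1 - p.2)) K μ ν D)
    {P : Measure (E × E)} (h1 : P.map Prod.fst = μ) (h2 : P.map Prod.snd = ν)
    (hP : ∫ p : E × E, h (p.1 - p.2) ∂P ≤ D) :
    ∃ T : E → E, Measurable T ∧ ∀ᵐ p ∂P, p.2 = T p.1 := by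
  have : IsProbabilityMeasure P := isProbabilityMeasure_of_map_eq measurable_fst h1
  have : ProperSpace E := FiniteDimensional.proper ℝ E
  have hc : Continuous fun p : E × E => h (p.1 - p.2) :=
    hh.convexOn.locallyLipschitz.continuous.comp (by fun_prop)
  obtain ⟨a, b, hle, hlim⟩ := hD.exists_seq_tendsto h1 h2 hK hμ hν hc hP
  obtain ⟨M, hM⟩ := ((hK.prod hK).image hc).bddAbove
  have hcM : ∀ x ∈ K, ∀ y ∈ K, h (x - y) ≤ M := fun x hx y hy => hM ⟨(x, y), ⟨hx, hy⟩, rfl⟩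
  let G : Set (E × E) := {p | p ∈ K ×ˢ K ∧
    Tendsto (fun n => a n p.1 + b n p.2) atTop (𝓝 (h (p.1 - p.2)))}
  have hG : ∀ᵐ p ∂P, p ∈ G := (ae_mem_prod_of_map_eq h1 h2 hμ hν).and hlim
  obtain ⟨ψ, M', hψ, hmin⟩ := exists_potential_of_tendsto (c := fun p : E × E => h (p.1 - p.2))
    (G := G) (fun n p hp q hq => hle n _ hp.1.1 _ hq.1.2) (fun p hp => hp.2)
    (fun p hp q hq => hcM _ hp.1.1 _ hq.1.2)
  refine exists_measurable_ae_eq_of_unique hG ?_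
  rw [h1]
  refine hμρ.ae_le ?_
  filter_upwards [hh.ae_minimizer_unique ρ (ι := G) (y := fun p => p.1.2)
    (ψ := fun p => ψ p.1.2) hK (fun p => p.2.1.2) (fun p => hψ _ p.2)] with x hx y y' hy hy'
  exact hx ⟨_, hy⟩ ⟨_, hy'⟩ (fun q => hmin _ hy _ q.2) (fun q => hmin _ hy' _ q.2)

section Graph

variable {E : Type*} [MeasurableSpace E] {μ ν : Measure E} {S : E → E}

lemma map_fst_map_graph (hS : Measurable S) :
    (μ.map fun x => (x, S x)).map Prod.fst = μ := by
  rw [Measure.map_map measurable_fst (by fun_prop)]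
  exact Measure.map_id

lemma map_snd_map_graph (hS : Measurable S) :
    (μ.map fun x => (x, S x)).map Prod.snd = μ.map S :=
  Measure.map_map measurable_snd (by fun_prop)

lemma map_eq_of_ae_eq_graph {P : Measure (E × E)} (h1 : P.map Prod.fst = μ)
    (h2 : P.map Prod.snd = ν) (hS : Measurable S) (hP : ∀ᵐ p ∂P, p.2 = S p.1) :
    μ.map S = ν := by
  rw [← h1, ← h2, Measure.map_map hS measurable_fst]
  exact Measure.map_congr (hP.mono fun p hp => hp.symm)

end Graph

/-- for a strictly convex `h : ℝ^d → ℝ` and compactly supported, absolutely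
continuous Borel probability measures `μ, ν` on `ℝ^d`, there is a Borel map `T` pushing
`μ` to `ν` that minimizes `∫ h (x - T x) dμ` among all such maps, and any two minimizers
agree `μ`-a.e. -/
theorem statement7 {d : ℕ} (h : (Fin d → ℝ) → ℝ) (hh : StrictConvexOn ℝ Set.univ h)
    (μ ν : Measure (Fin d → ℝ)) [IsProbabilityMeasure μ] [IsProbabilityMeasure ν]
    (hμac : μ ≪ volume) (hνac : ν ≪ volume)
    (hμc : ∃ K : Set (Fin d → ℝ), IsCompact K ∧ μ Kᶜ = 0)
    (hνc : ∃ K : Set (Fin d → ℝ), IsCompact K ∧ ν Kᶜ = 0) :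
    ∃ T : (Fin d → ℝ) → (Fin d → ℝ), Measurable T ∧ Measure.map T μ = ν ∧
      (∀ S : (Fin d → ℝ) → (Fin d → ℝ), Measurable S → Measure.map S μ = ν →
        ∫ x, h (x - T x) ∂μ ≤ ∫ x, h (x - S x) ∂μ) ∧
      (∀ T₁ T₂ : (Fin d → ℝ) → (Fin d → ℝ),
        Measurable T₁ → Measure.map T₁ μ = ν →
        (∀ S, Measurable S → Measure.map S μ = ν →
          ∫ x, h (x - T₁ x) ∂μ ≤ ∫ x, h (x - S x) ∂μ) →
        Measurable T₂ → Measure.map T₂ μ = ν →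
        (∀ S, Measurable S → Measure.map S μ = ν →
          ∫ x, h (x - T₂ x) ∂μ ≤ ∫ x, h (x - S x) ∂μ) →
        T₁ =ᵐ[μ] T₂) := by
  obtain ⟨K₁, hK₁, hμ₁⟩ := hμc
  obtain ⟨K₂, hK₂, hν₂⟩ := hνc
  have hK : IsCompact (K₁ ∪ K₂) := hK₁.union hK₂
  have hμK : μ (K₁ ∪ K₂)ᶜ = 0 :=
    measure_mono_null (Set.compl_subset_compl.2 Set.subset_union_left) hμ₁
  have hνK : ν (K₁ ∪ K₂)ᶜ = 0 :=
    measure_mono_null (Set.compl_subset_compl.2 Set.subset_union_right) hν₂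
  have hc : Continuous fun p : (Fin d → ℝ) × (Fin d → ℝ) => h (p.1 - p.2) :=
    hh.convexOn.locallyLipschitz.continuous.comp (by fun_prop)
  obtain ⟨P, h1, h2, hD⟩ := exists_coupling_dualValueAtLeast hK hμK hνK hc
  have hcost : ∀ S : (Fin d → ℝ) → (Fin d → ℝ), Measurable S →
      ∫ p, h (p.1 - p.2) ∂(μ.map fun x => (x, S x)) = ∫ x, h (x - S x) ∂μ := fun S hS =>
    integral_map (by fun_prop) hc.aestronglyMeasurable
  have hge : ∀ S : (Fin d → ℝ) → (Fin d → ℝ), Measurable S → μ.map S = ν →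
      Integrable (fun p => h (p.1 - p.2)) (μ.map fun x => (x, S x)) ∧
      ∫ p, h (p.1 - p.2) ∂P ≤ ∫ x, h (x - S x) ∂μ := fun S hS hSν => by
    rw [← hcost S hS]
    exact hD.le_integral (map_fst_map_graph hS) ((map_snd_map_graph hS).trans hSν) hK hμK hνK hc
  obtain ⟨T, hT, hPT⟩ := hh.exists_measurable_ae_eq_of_optimal volume hK hμac hμK hνK
    hD h1 h2 le_rfl
  have hTν : μ.map T = ν := map_eq_of_ae_eq_graph h1 h2 hT hPT
  have hTcost : ∫ x, h (x - T x) ∂μ = ∫ p, h (p.1 - p.2) ∂P := by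
    have hg : Continuous h := hh.convexOn.locallyLipschitz.continuous
    conv_lhs => rw [← h1]
    rw [integral_map measurable_fst.aemeasurable (f := fun x => h (x - T x))
      (hg.measurable.comp (measurable_id.sub hT)).aestronglyMeasurable]
    exact integral_congr_ae (hPT.mono fun p hp => by simp only [hp])
  refine ⟨T, hT, hTν, fun S hS hSν => hTcost.trans_le (hge S hS hSν).2, ?_⟩
  intro T₁ T₂ hT₁ hT₁ν hmin₁ hT₂ hT₂ν hmin₂
  let Q : Measure ((Fin d → ℝ) × (Fin d → ℝ)) :=
    (2⁻¹ : NNReal) • (μ.map (fun x => (x, T₁ x)) + μ.map fun x => (x, T₂ x))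
  have hhalf : ∀ κ : Measure (Fin d → ℝ), (2⁻¹ : NNReal) • (κ + κ) = κ := fun κ => by
    rw [← two_smul NNReal κ, inv_smul_smul₀ two_ne_zero]
  have hQ1 : Q.map Prod.fst = μ := by
    rw [Measure.map_smul, Measure.map_add _ _ measurable_fst, map_fst_map_graph hT₁,
      map_fst_map_graph hT₂, hhalf]
  have hQ2 : Q.map Prod.snd = ν := by
    rw [Measure.map_smul, Measure.map_add _ _ measurable_snd, map_snd_map_graph hT₁,
      map_snd_map_graph hT₂, hT₁ν, hT₂ν, hhalf]
  have hQ : ∫ p, h (p.1 - p.2) ∂Q ≤ ∫ p, h (p.1 - p.2) ∂P := by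
    rw [integral_smul_nnreal_measure, integral_add_measure (hge T₁ hT₁ hT₁ν).1
      (hge T₂ hT₂ hT₂ν).1, hcost T₁ hT₁, hcost T₂ hT₂, ← hTcost, NNReal.smul_def]
    have e1 := hmin₁ T hT hTν
    have e2 := hmin₂ T hT hTν
    simp only [NNReal.coe_inv, NNReal.coe_ofNat, smul_eq_mul]
    linarith
  obtain ⟨S, hS, hQS⟩ := hh.exists_measurable_ae_eq_of_optimal volume hK hμac hμK hνK
    hD hQ1 hQ2 hQ
  have hQS' := (Measure.ae_smul_measure_iff (c := (2⁻¹ : NNReal)) (by simp)).1 hQS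
  rw [ae_add_measure_iff] at hQS'
  have e1 := ae_of_ae_map (by fun_prop) hQS'.1
  have e2 := ae_of_ae_map (by fun_prop) hQS'.2
  filter_upwards [e1, e2] with x hx₁ hx₂
  exact hx₁.trans hx₂.symm
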